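/- arXiv:math/0504541 — 5 statements merged into one kernel-verified Lean document; each statement's English description precedes it below -/
import Mathlib

section
/- (Equivalence Theorem, even case) Let A be a unital commutative associative algebra over a commutative ring R and Δ : A → A an R-linear map. Then for all r ≥ 1 and a₁,…,a_r ∈ A: Γ^r_Δ(a₁,…,a_r)(1) = Φ^r_Δ(a₁,…,a_r) = Σ_{S ⊆ {1,…,r}} (−1)^{|S|} (∏_{i∈S} a_i) · Δ(∏_{i∉S} a_i), where each product over a subset of indices is taken in increasing index order and the empty product is 1. -/
/-- The recursively defined operators `Φʳ_Δ`, implemented on the reversed argument list. -/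
def PhiAux {V : Type*} [One V] [Mul V] [Sub V] (Δ : V → V) : List V → V
  | [] => Δ 1
  | [a] => Δ a - Δ 1 * a
  | b :: a :: rest =>
      PhiAux Δ ((a * b) :: rest) - PhiAux Δ (a :: rest) * b - a * PhiAux Δ (b :: rest)
termination_by l => l.length

/-- `Phi Δ [a₁, …, a_r] = Φʳ_Δ(a₁,…,a_r)`. -/
def Phi {V : Type*} [One V] [Mul V] [Sub V] (Δ : V → V) (l : List V) : V :=
  PhiAux Δ l.reverse

/-- The iterated commutator of `D` with multiplication operators, evaluated at `1`, satisfies the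
recursion defining `PhiAux`. -/
theorem foldr_commutator_mulLeft_apply_one {R A : Type*} [CommRing R] [CommRing A] [Algebra R A]
    (D : A →ₗ[R] A) : ∀ l : List A,
    (l.foldr (fun b S => S ∘ₗ LinearMap.mulLeft R b - LinearMap.mulLeft R b ∘ₗ S) D) 1 =
      PhiAux (⇑D) l
  | [] => by simp [PhiAux]
  | [a] => by simp [PhiAux, mul_comm]
  | b :: a :: rest => by
      rw [PhiAux, ← foldr_commutator_mulLeft_apply_one D (a * b :: rest),
        ← foldr_commutator_mulLeft_apply_one D (a :: rest), ← foldr_commutator_mulLeft_apply_one D (b :: rest)]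
      simp only [List.foldr_cons, LinearMap.sub_apply, LinearMap.comp_apply,
        LinearMap.mulLeft_apply, mul_one]
      ring
termination_by l => l.length

/-- Expansion of the iterated commutator of `D` with multiplication operators. -/
theorem foldl_commutator_mulLeft_apply {R A ι : Type*} [CommRing R] [CommRing A] [Algebra R A]
    [DecidableEq ι] (a : ι → A) (l : List ι) (hl : l.Nodup) (D : A →ₗ[R] A) (x : A) :
    ((l.map fun i => LinearMap.mulLeft R (a i)).foldl
        (fun S T => S ∘ₗ T - T ∘ₗ S) D) x =
      ∑ t ∈ l.toFinset.powerset,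
        (-1 : A) ^ t.card * ((∏ i ∈ t, a i) * D ((∏ i ∈ l.toFinset \ t, a i) * x)) := by
  induction l generalizing D with
  | nil => simp
  | cons j l ih =>
    obtain ⟨hj, hl⟩ := List.nodup_cons.mp hl
    have hj' : j ∉ l.toFinset := by simpa using hj
    rw [List.map_cons, List.foldl_cons, ih hl, List.toFinset_cons,
      Finset.sum_powerset_insert hj', ← Finset.sum_add_distrib]
    refine Finset.sum_congr rfl fun t ht => ?_
    have hjt : j ∉ t := fun h => hj' (Finset.mem_powerset.mp ht h)
    rw [Finset.insert_sdiff_of_notMem _ hjt, Finset.prod_insert (by simp [hj]),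
      Finset.card_insert_of_notMem hjt, Finset.prod_insert hjt,
      Finset.insert_sdiff_insert, Finset.sdiff_insert_of_notMem hj']
    simp only [LinearMap.sub_apply, LinearMap.comp_apply, LinearMap.mulLeft_apply, mul_assoc]
    ring

/-- The product over the sorted list of elements of a finset is the product over the finset. -/
theorem prod_map_sort {ι A : Type*} [LinearOrder ι] [CommMonoid A] (a : ι → A) (s : Finset ι) :
    ((s.sort (· ≤ ·)).map a).prod = ∏ i ∈ s, a i := by
  rw [← List.prod_toFinset a (s.sort_nodup (· ≤ ·)), Finset.sort_toFinset]


/-- Equivalence Theorem (even case): on a unital commutative associative algebra,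
`Γʳ_Δ(a₁,…,a_r)(1) = Φʳ_Δ(a₁,…,a_r) = Σ_{S} (−1)^{|S|} (∏_{i∈S} aᵢ)·Δ(∏_{i∉S} aᵢ)`,
where `Γʳ_Δ(a₁,…,a_r) = [⋯[[Δ,ℓ_{a₁}],ℓ_{a₂}],⋯,ℓ_{a_r}]` in `End(A)`. -/
theorem equivalence_theorem
    (R A : Type*) [CommRing R] [CommRing A] [Algebra R A]
    (Δ : A →ₗ[R] A) (r : ℕ) (hr : 1 ≤ r) (a : Fin r → A) :
    ((List.ofFn fun i => LinearMap.mulLeft R (a i)).foldl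
        (fun S T => S ∘ₗ T - T ∘ₗ S) Δ) 1 = Phi (⇑Δ) (List.ofFn a) ∧
    Phi (⇑Δ) (List.ofFn a) =
      ∑ s : Finset (Fin r),
        (-1 : A) ^ s.card *
          (((s.sort (· ≤ ·)).map a).prod * Δ (((sᶜ.sort (· ≤ ·)).map a).prod)) := by
  have hPhi : ((List.ofFn fun i => LinearMap.mulLeft R (a i)).foldl
      (fun S T => S ∘ₗ T - T ∘ₗ S) Δ) 1 = Phi (⇑Δ) (List.ofFn a) := by
    rw [Phi, ← foldr_commutator_mulLeft_apply_one Δ, List.foldr_reverse,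
      List.ofFn_eq_map, List.ofFn_eq_map, List.foldl_map, List.foldl_map]
  refine ⟨hPhi, ?_⟩
  rw [← hPhi, List.ofFn_eq_map, foldl_commutator_mulLeft_apply a _ (List.nodup_finRange r)]
  simp [prod_map_sort, Finset.compl_eq_univ_sdiff]
end

section
/- Let A be a unital commutative associative algebra over a commutative ring R, and let Δ₁, Δ₂ : A → A be R-linear maps of order at most k ≥ 0 and at most l ≥ 0 respectively (i.e., Γ^{k+1}_{Δ₁} and Γ^{l+1}_{Δ₂} vanish identically). Then the commutator [Δ₁,Δ₂] = Δ₁∘Δ₂ − Δ₂∘Δ₁ has order at most k+l−1, i.e., Γ^{k+l}_{[Δ₁,Δ₂]} vanishes identically (with the convention Γ⁰_Δ = Δ, so that for k = l = 0 the commutator is zero). -/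
/-- Grothendieck operator: `Gamma Δ [a₁,…,a_r] = [⋯[[Δ,ℓ_{a₁}],ℓ_{a₂}],⋯,ℓ_{a_r}]`
as a linear endomorphism; `Gamma Δ [] = Δ` (the convention `Γ⁰_Δ = Δ`). -/
def Gamma {R A : Type*} [CommRing R] [CommRing A] [Algebra R A]
    (Δ : A →ₗ[R] A) (l : List A) : A →ₗ[R] A :=
  (l.map fun a => LinearMap.mulLeft R a).foldl (fun S T => S ∘ₗ T - T ∘ₗ S) Δ

theorem Gamma_cons {R A : Type*} [CommRing R] [CommRing A] [Algebra R A]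
    (Δ : A →ₗ[R] A) (a : A) (s : List A) :
    Gamma Δ (a :: s) =
      Gamma (Δ ∘ₗ LinearMap.mulLeft R a - LinearMap.mulLeft R a ∘ₗ Δ) s :=
  rfl

theorem Gamma_add {R A : Type*} [CommRing R] [CommRing A] [Algebra R A]
    (S T : A →ₗ[R] A) (s : List A) : Gamma (S + T) s = Gamma S s + Gamma T s := by
  induction s generalizing S T with
  | nil => rfl
  | cons a s ih =>
    rw [Gamma_cons, Gamma_cons, Gamma_cons, ← ih, LinearMap.add_comp, LinearMap.comp_add]
    congr 1
    abel

theorem Gamma_zero {R A : Type*} [CommRing R] [CommRing A] [Algebra R A]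
    (s : List A) : Gamma (0 : A →ₗ[R] A) s = 0 := by
  simpa using Gamma_add (0 : A →ₗ[R] A) 0 s

/-- The Jacobi identity for bracketing a commutator with a left multiplication. -/
theorem Gamma_commutator_cons {R A : Type*} [CommRing R] [CommRing A] [Algebra R A]
    (S T : A →ₗ[R] A) (a : A) (s : List A) :
    Gamma (S ∘ₗ T - T ∘ₗ S) (a :: s) =
      Gamma (Gamma S [a] ∘ₗ T - T ∘ₗ Gamma S [a]) s +
        Gamma (S ∘ₗ Gamma T [a] - Gamma T [a] ∘ₗ S) s := by
  rw [← Gamma_add, Gamma_cons]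
  congr 1
  ext x
  simp [Gamma]
  ring

/-- A linear map commuting with all left multiplications is itself a multiplication. -/
theorem apply_eq_mul_of_Gamma_singleton_eq_zero {R A : Type*} [CommRing R] [CommRing A]
    [Algebra R A] {S : A →ₗ[R] A} (h : ∀ a, Gamma S [a] = 0) (x : A) : S x = x * S 1 := by
  simpa [Gamma, sub_eq_zero] using LinearMap.congr_fun (h x) 1

theorem Gamma_commutator_eq_zero {R A : Type*} [CommRing R] [CommRing A] [Algebra R A]
    (s : List A) (k l : ℕ) (hs : s.length = k + l) (S T : A →ₗ[R] A)
    (hS : ∀ t : List A, t.length = k + 1 → Gamma S t = 0)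
    (hT : ∀ t : List A, t.length = l + 1 → Gamma T t = 0) :
    Gamma (S ∘ₗ T - T ∘ₗ S) s = 0 := by
  induction s generalizing k l S T with
  | nil =>
    obtain ⟨rfl, rfl⟩ : k = 0 ∧ l = 0 := by simpa [eq_comm] using hs
    have hS' := apply_eq_mul_of_Gamma_singleton_eq_zero fun a => hS [a] rfl
    have hT' := apply_eq_mul_of_Gamma_singleton_eq_zero fun a => hT [a] rfl
    ext x
    change S (T x) - T (S x) = 0
    rw [hS' (T x), hT' x, hT' (S x), hS' x]
    ring
  | cons a s ih =>
    rw [List.length_cons] at hs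
    have h₁ : Gamma (Gamma S [a] ∘ₗ T - T ∘ₗ Gamma S [a]) s = 0 := by
      cases k with
      | zero => simp [hS [a] rfl, Gamma_zero]
      | succ k => exact ih k l (by omega) _ _ (fun t ht => hS (a :: t) (by simp [ht])) hT
    have h₂ : Gamma (S ∘ₗ Gamma T [a] - Gamma T [a] ∘ₗ S) s = 0 := by
      cases l with
      | zero => simp [hT [a] rfl, Gamma_zero]
      | succ l => exact ih k l (by omega) _ _ hS (fun t ht => hT (a :: t) (by simp [ht]))
    rw [Gamma_commutator_cons, h₁, h₂, add_zero]

/-- The commutator of differential operators of orders at most `k` and `l` has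
order at most `k + l − 1`, i.e. `Γ^{k+l}_{[Δ₁,Δ₂]} ≡ 0` (for `k = l = 0` the
commutator itself vanishes, by the convention `Γ⁰_Δ = Δ`). -/
theorem commutator_order_le_add_sub_one
    (R A : Type*) [CommRing R] [CommRing A] [Algebra R A]
    (k l : ℕ) (Δ₁ Δ₂ : A →ₗ[R] A)
    (h₁ : ∀ a : Fin (k + 1) → A, Gamma Δ₁ (List.ofFn a) = 0)
    (h₂ : ∀ a : Fin (l + 1) → A, Gamma Δ₂ (List.ofFn a) = 0) :
    ∀ a : Fin (k + l) → A, Gamma (Δ₁ ∘ₗ Δ₂ - Δ₂ ∘ₗ Δ₁) (List.ofFn a) = 0 := by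
  have key {n : ℕ} {Δ : A →ₗ[R] A} (h : ∀ a : Fin n → A, Gamma Δ (List.ofFn a) = 0)
      (t : List A) (ht : t.length = n) : Gamma Δ t = 0 := by
    subst ht
    simpa using h t.get
  intro a
  exact Gamma_commutator_eq_zero _ k l (List.length_ofFn) _ _ (key h₁) (key h₂)
end

section
/- (Derived Lie Brackets Theorem, part (i), even case) Let L be a Lie algebra over a commutative ring R and d : L → L an R-linear map satisfying d⁅a,b⁆ = ⁅da,b⁆ + ⁅a,db⁆ for all a,b ∈ L and d∘d = 0. Define the derived bracket [a,b]_d = ⁅da,b⁆. Then the derived bracket satisfies the left Leibniz identity: [a,[b,c]_d]_d = [[a,b]_d,c]_d + [b,[a,c]_d]_d for all a,b,c ∈ L. -/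
/-- Derived Lie Brackets Theorem, part (i), even case: the derived bracket
`[a,b]_d = ⁅da,b⁆` of an odd square-zero derivation `d` satisfies the left
Leibniz identity `[a,[b,c]_d]_d = [[a,b]_d,c]_d + [b,[a,c]_d]_d`. -/
theorem derived_bracket_left_leibniz
    (R L : Type*) [CommRing R] [LieRing L] [LieAlgebra R L]
    (d : L →ₗ[R] L)
    (hder : ∀ a b : L, d ⁅a, b⁆ = ⁅d a, b⁆ + ⁅a, d b⁆)
    (hsq : d ∘ₗ d = 0) :
    ∀ a b c : L, ⁅d a, ⁅d b, c⁆⁆ = ⁅d ⁅d a, b⁆, c⁆ + ⁅d b, ⁅d a, c⁆⁆ := by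
  intro a b c
  have hdd : d (d a) = 0 := LinearMap.congr_fun hsq a
  rw [hder, hdd, zero_lie, zero_add]
  exact leibniz_lie (d a) (d b) c
end

section
/- Let L be a Lie algebra over a commutative ring R, let L₀ ⊆ L be an abelian Lie subalgebra, and let Δ ∈ L satisfy ⁅Δ,⁅Δ,x⁆⁆ = 0 for all x ∈ L and ⁅⁅Δ,a⁆,b⁆ ∈ L₀ for all a,b ∈ L₀. Then for all a,b ∈ L₀ one has ⁅⁅Δ,a⁆,⁅Δ,b⁆⁆ = ⁅Δ,⁅a,⁅Δ,b⁆⁆⁆, so that the submodule ⁅Δ,L₀⁆ = {⁅Δ,a⁆ : a ∈ L₀} spans a Lie subalgebra of L, and the submodule spanned by L₀ together with ⁅Δ,L₀⁆ is a Lie subalgebra of L in which L₀ is an abelian ideal. -/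
/-- Brackets of elements of two spans lie in a submodule as soon as brackets of generators do. -/
theorem lie_mem_of_mem_span {R L : Type*} [CommRing R] [LieRing L] [LieAlgebra R L]
    {s t : Set L} {N : Submodule R L} (h : ∀ x ∈ s, ∀ y ∈ t, ⁅x, y⁆ ∈ N) {x y : L}
    (hx : x ∈ Submodule.span R s) (hy : y ∈ Submodule.span R t) : ⁅x, y⁆ ∈ N := by
  induction hx, hy using Submodule.span_induction₂ with
  | mem_mem x y hx hy => exact h x hx y hy
  | zero_left y _ => simp
  | zero_right x _ => simp
  | add_left x y z _ _ _ h₁ h₂ => rw [add_lie]; exact N.add_mem h₁ h₂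
  | add_right x y z _ _ _ h₁ h₂ => rw [lie_add]; exact N.add_mem h₁ h₂
  | smul_left r x y _ _ h₁ => rw [smul_lie]; exact N.smul_mem r h₁
  | smul_right r x y _ _ h₁ => rw [lie_smul]; exact N.smul_mem r h₁

/-- Proposition ("kosschone" setting): if `L₀` is an abelian Lie subalgebra of `L`,
`Δ ∈ L` is square-zero in the adjoint sense, and `⁅⁅Δ,L₀⁆,L₀⁆ ⊆ L₀`, then
`⁅⁅Δ,a⁆,⁅Δ,b⁆⁆ = ⁅Δ,⁅a,⁅Δ,b⁆⁆⁆`, the span of `⁅Δ,L₀⁆` is closed under the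
bracket, and the span of `L₀ ∪ ⁅Δ,L₀⁆` is a Lie subalgebra in which `L₀` is an
(abelian) ideal. -/
theorem adjoint_square_zero_semidirect_sum
    (R L : Type*) [CommRing R] [LieRing L] [LieAlgebra R L]
    (L₀ : LieSubalgebra R L)
    (habelian : ∀ a ∈ L₀, ∀ b ∈ L₀, ⁅a, b⁆ = 0)
    (Δ : L)
    (hsq : ∀ x : L, ⁅Δ, ⁅Δ, x⁆⁆ = 0)
    (hclosed : ∀ a ∈ L₀, ∀ b ∈ L₀, ⁅⁅Δ, a⁆, b⁆ ∈ L₀) :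
    (∀ a ∈ L₀, ∀ b ∈ L₀, ⁅⁅Δ, a⁆, ⁅Δ, b⁆⁆ = ⁅Δ, ⁅a, ⁅Δ, b⁆⁆⁆) ∧
    (∀ x ∈ Submodule.span R {y : L | ∃ a ∈ L₀, y = ⁅Δ, a⁆},
      ∀ z ∈ Submodule.span R {y : L | ∃ a ∈ L₀, y = ⁅Δ, a⁆},
        ⁅x, z⁆ ∈ Submodule.span R {y : L | ∃ a ∈ L₀, y = ⁅Δ, a⁆}) ∧
    (∀ x ∈ Submodule.span R ((L₀ : Set L) ∪ {y : L | ∃ a ∈ L₀, y = ⁅Δ, a⁆}),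
      ∀ z ∈ Submodule.span R ((L₀ : Set L) ∪ {y : L | ∃ a ∈ L₀, y = ⁅Δ, a⁆}),
        ⁅x, z⁆ ∈ Submodule.span R ((L₀ : Set L) ∪ {y : L | ∃ a ∈ L₀, y = ⁅Δ, a⁆})) ∧
    (∀ x ∈ Submodule.span R ((L₀ : Set L) ∪ {y : L | ∃ a ∈ L₀, y = ⁅Δ, a⁆}),
      ∀ a ∈ L₀, ⁅x, a⁆ ∈ L₀) := by
  have formula : ∀ a b : L, ⁅⁅Δ, a⁆, ⁅Δ, b⁆⁆ = ⁅Δ, ⁅a, ⁅Δ, b⁆⁆⁆ := fun a b => by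
    rw [leibniz_lie Δ a, hsq, lie_zero, add_zero]
  have swapped : ∀ a ∈ L₀, ∀ b ∈ L₀, ⁅a, ⁅Δ, b⁆⁆ ∈ L₀ := fun a ha b hb => by
    rw [← lie_skew]
    exact L₀.neg_mem (hclosed b hb a ha)
  refine ⟨fun a _ b _ => formula a b, fun x hx z hz => lie_mem_of_mem_span ?_ hx hz,
    fun x hx z hz => lie_mem_of_mem_span ?_ hx hz, fun x hx a ha =>
      lie_mem_of_mem_span (N := L₀.toSubmodule) ?_ hx (Submodule.subset_span ha)⟩
  · rintro _ ⟨a, ha, rfl⟩ _ ⟨b, hb, rfl⟩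
    exact Submodule.subset_span ⟨_, swapped a ha b hb, formula a b⟩
  · rintro x (hx | ⟨a, ha, rfl⟩) y (hy | ⟨b, hb, rfl⟩) <;> apply Submodule.subset_span
    · exact .inl (L₀.lie_mem hx hy)
    · exact .inl (swapped x hx b hb)
    · exact .inl (hclosed a ha y hy)
    · exact .inr ⟨_, swapped a ha b hb, formula a b⟩
  · rintro x (hx | ⟨b, hb, rfl⟩) y hy
    · exact L₀.lie_mem hx hy
    · exact hclosed b hb y hy
end

section
/- Let V be a unital algebra over a commutative ring R (not necessarily associative or commutative), let Q : V → V be an R-linear map with Q(ab) = Q(a)·b + a·Q(b) for all a,b ∈ V and Q∘Q = 0, and let Δ : V → V be an R-linear map with Q∘Δ + Δ∘Q = 0. Then for every r ≥ 1, if a₁,…,a_r ∈ Ker(Q) then Φ^r_Δ(a₁,…,a_r) ∈ Ker(Q). -/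
/-- If `Q` is a derivation and `Δ` maps `Ker(Q)` to itself, then so do the operators `PhiAux Δ`. -/
theorem map_phiAux_eq_zero {R V : Type*} [CommRing R] [NonAssocRing V] [Module R V]
    {Q : V →ₗ[R] V} {Δ : V → V}
    (hQder : ∀ a b : V, Q (a * b) = Q a * b + a * Q b)
    (hΔ : ∀ x, Q x = 0 → Q (Δ x) = 0) :
    ∀ l : List V, (∀ x ∈ l, Q x = 0) → Q (PhiAux Δ l) = 0 := by
  have hone : Q 1 = 0 := by simpa using hQder 1 1
  have hmul : ∀ a b, Q a = 0 → Q b = 0 → Q (a * b) = 0 := fun a b ha hb => by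
    simp [hQder, ha, hb]
  intro l
  induction l using PhiAux.induct with
  | case1 =>
    intro _
    simpa [PhiAux] using hΔ 1 hone
  | case2 a =>
    intro h
    have ha : Q a = 0 := h a (by simp)
    simp [PhiAux, hΔ a ha, hmul _ _ (hΔ 1 hone) ha]
  | case3 b a rest ih₁ ih₂ ih₃ =>
    intro h
    simp only [List.forall_mem_cons] at h ih₁ ih₂ ih₃
    obtain ⟨hb, ha, hr⟩ := h
    simp [PhiAux, ih₁ ⟨hmul a b ha hb, hr⟩, hmul _ _ (ih₂ ⟨ha, hr⟩) hb,
      hmul _ _ ha (ih₃ ⟨hb, hr⟩)]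

/-- (Part of the Cohomological Derived Brackets Theorem.) If `Q` is a square-zero
derivation of a unital algebra `V` and `Δ` anticommutes with `Q`, then the
operators `Φʳ_Δ` preserve `Ker(Q)`. -/
theorem phi_preserves_ker
    (R V : Type*) [CommRing R] [NonAssocRing V] [Module R V]
    (Q Δ : V →ₗ[R] V)
    (hQder : ∀ a b : V, Q (a * b) = Q a * b + a * Q b)
    (hQQ : Q ∘ₗ Q = 0)
    (hanti : Q ∘ₗ Δ + Δ ∘ₗ Q = 0) :
    ∀ r : ℕ, 1 ≤ r → ∀ a : Fin r → V,
      (∀ i, Q (a i) = 0) → Q (Phi (⇑Δ) (List.ofFn a)) = 0 := by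
  intro r _ a ha
  refine map_phiAux_eq_zero hQder (fun x hx => ?_) _ (by simpa [List.mem_ofFn] using ha)
  simpa [hx] using LinearMap.congr_fun hanti x
end
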